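/- (Egorov property of the kernel-formula operators) For every g ∈ SL(2, ZMod p) with det(g − I) ≠ 0, the operator ρ(g) = p⁻¹ · σ(−det(κ(g) + I)) · Σ_{v ∈ (ZMod p)²} ψ(4⁻¹·ω(κ(g)·v, v)) · π(v, 0), where κ(g) = (g + I)(g − I)⁻¹, is invertible and satisfies ρ(g) ∘ π(v, z) ∘ ρ(g)⁻¹ = π(g·v, z) for all v ∈ (ZMod p)² and z ∈ ZMod p. -/

import Mathlib

open scoped BigOperators

noncomputable section

namespace DFTWeil

open scoped Classical

/-- Multiplication of the Heisenberg group `H = (V × V) × Z`,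
`(v,z)·(v',z') = (v+v', z+z'+2⁻¹ ω(v,v'))` with `ω((t,w),(t',w')) = t w' - w t'`. -/
def hMul {p : ℕ} (a b : (ZMod p × ZMod p) × ZMod p) : (ZMod p × ZMod p) × ZMod p :=
  (a.1 + b.1, a.2 + b.2 + (2 : ZMod p)⁻¹ * (a.1.1 * b.1.2 - a.1.2 * b.1.1))

/-- The additive character `ψ(z) = exp(2πi z/p)`. -/
def psi (p : ℕ) (z : ZMod p) : ℂ :=
  Complex.exp (2 * Real.pi * Complex.I * (z.val : ℂ) / p)

/-- The standard realization of the Heisenberg representation: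
`(π((t,w),z) f)(x) = ψ(z + 2⁻¹ t w + w x) f(x+t)`. -/
def heis (p : ℕ) (h : (ZMod p × ZMod p) × ZMod p) :
    (ZMod p → ℂ) →ₗ[ℂ] (ZMod p → ℂ) where
  toFun f x := psi p (h.2 + (2 : ZMod p)⁻¹ * h.1.1 * h.1.2 + h.1.2 * x) * f (x + h.1.1)
  map_add' f g := by funext x; simp [mul_add]
  map_smul' c f := by funext x; simp [Pi.smul_apply, smul_eq_mul]; ring

/-- The Legendre character `σ` of `ZMod p` (extended by `0` at `0`). -/
def sgm (p : ℕ) (a : ZMod p) : ℂ := if a = 0 then 0 else if IsSquare a then 1 else -1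

/-- Action of a `2 × 2` matrix on a column vector `v ∈ (ZMod p)²`. -/
def matVec {p : ℕ} (m : Matrix (Fin 2) (Fin 2) (ZMod p)) (v : ZMod p × ZMod p) :
    ZMod p × ZMod p :=
  (m 0 0 * v.1 + m 0 1 * v.2, m 1 0 * v.1 + m 1 1 * v.2)

/-- The symplectic form `ω((t,w),(t',w')) = t w' - w t'`. -/
def omg {p : ℕ} (v w : ZMod p × ZMod p) : ZMod p := v.1 * w.2 - v.2 * w.1

/-- The Cayley transform `κ(g) = (g+I)(g-I)⁻¹`. -/
def cayley {p : ℕ} (g : Matrix (Fin 2) (Fin 2) (ZMod p)) : Matrix (Fin 2) (Fin 2) (ZMod p) :=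
  (g + 1) * (g - 1)⁻¹

/-- The Weil operator given by the kernel formula
`ρ(g) = p⁻¹ σ(-det(κ(g)+I)) Σ_v ψ(4⁻¹ ω(κ(g)v,v)) π(v,0)`. -/
def weilOp (p : ℕ) [Fact p.Prime] (g : Matrix (Fin 2) (Fin 2) (ZMod p)) :
    (ZMod p → ℂ) →ₗ[ℂ] (ZMod p → ℂ) :=
  (p : ℂ)⁻¹ • sgm p (-((cayley g + 1).det)) •
    ∑ v : ZMod p × ZMod p,
      psi p ((4 : ZMod p)⁻¹ * omg (matVec (cayley g) v) v) • heis p (v, 0)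

variable {p : ℕ}

theorem psi_eq_stdAddChar [NeZero p] (z : ZMod p) : psi p z = ZMod.stdAddChar z := by
  rw [psi, ZMod.stdAddChar_apply, ZMod.toCircle_apply]

theorem psi_add [NeZero p] (a b : ZMod p) : psi p (a + b) = psi p a * psi p b := by
  simp only [psi_eq_stdAddChar, AddChar.map_add_eq_mul]

theorem psi_zero [NeZero p] : psi p 0 = 1 := by
  simp only [psi_eq_stdAddChar, AddChar.map_zero_eq_one]

theorem sum_psi_mul [NeZero p] (a : ZMod p) :
    ∑ x : ZMod p, psi p (x * a) = if a = 0 then (p : ℂ) else 0 := by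
  simp only [psi_eq_stdAddChar]
  rw [AddChar.sum_mulShift a (ZMod.isPrimitive_stdAddChar p)]
  simp [ZMod.card]

theorem sum_psi_linear [NeZero p] (a b : ZMod p) :
    ∑ u : ZMod p × ZMod p, psi p (u.1 * a + u.2 * b) =
      if a = 0 ∧ b = 0 then (p : ℂ) ^ 2 else 0 := by
  simp only [psi_add, Fintype.sum_prod_type]
  rw [← Finset.sum_mul_sum, sum_psi_mul, sum_psi_mul]
  by_cases ha : a = 0 <;> by_cases hb : b = 0 <;> simp [ha, hb, sq]

theorem two_ne_zero_of_prime [Fact p.Prime] (hp : p ≠ 2) : (2 : ZMod p) ≠ 0 :=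
  Ring.two_ne_zero (by rwa [ZMod.ringChar_zmod_n])

theorem heis_comp [Fact p.Prime] (hp : p ≠ 2) (h k : (ZMod p × ZMod p) × ZMod p) :
    heis p h ∘ₗ heis p k = heis p (hMul h k) := by
  have h2 := two_ne_zero_of_prime hp
  ext f x
  simp only [LinearMap.comp_apply, heis, LinearMap.coe_mk, AddHom.coe_mk, hMul, Prod.fst_add,
    Prod.snd_add]
  rw [← mul_assoc, ← psi_add, add_assoc x]
  congr 2
  field_simp
  ring

theorem heis_eq_smul [NeZero p] (v : ZMod p × ZMod p) (z : ZMod p) :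
    heis p (v, z) = psi p z • heis p (v, 0) := by
  ext f x
  simp only [heis, LinearMap.smul_apply, LinearMap.comp_apply, LinearMap.coe_mk,
    AddHom.coe_mk,
    Pi.smul_apply, smul_eq_mul]
  rw [← mul_assoc, ← psi_add]
  congr 2
  ring

theorem heis_zero [NeZero p] : heis p (0, 0) = LinearMap.id := by
  ext f x
  simp [heis, psi_zero]

/-- The operator `Σ_v ψ(4⁻¹ ω(m v, v)) π(v,0)`. -/
def gaussOp (p : ℕ) [NeZero p] (m : Matrix (Fin 2) (Fin 2) (ZMod p)) :
    (ZMod p → ℂ) →ₗ[ℂ] (ZMod p → ℂ) :=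
  ∑ v : ZMod p × ZMod p, psi p ((4 : ZMod p)⁻¹ * omg (matVec m v) v) • heis p (v, 0)

theorem gaussOp_comp_heis [Fact p.Prime] (hp : p ≠ 2)
    (m : Matrix (Fin 2) (Fin 2) (ZMod p)) (v : ZMod p × ZMod p) (z : ZMod p) :
    gaussOp p m ∘ₗ heis p (v, z) = ∑ s : ZMod p × ZMod p,
      psi p ((4 : ZMod p)⁻¹ * omg (matVec m (s - v)) (s - v) + (z + 2⁻¹ * omg s v)) •
        heis p (s, 0) := by
  rw [gaussOp, ← Module.End.mul_eq_comp, Finset.sum_mul]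
  refine Fintype.sum_equiv (Equiv.addRight v) _ _ fun u => ?_
  simp only [Equiv.coe_addRight, add_sub_cancel_right]
  rw [Module.End.mul_eq_comp, LinearMap.smul_comp, heis_comp hp, hMul, heis_eq_smul, smul_smul,
    ← psi_add]
  congr 3
  simp only [omg, Prod.fst_add, Prod.snd_add]
  ring

theorem heis_comp_gaussOp [Fact p.Prime] (hp : p ≠ 2)
    (m : Matrix (Fin 2) (Fin 2) (ZMod p)) (v : ZMod p × ZMod p) (z : ZMod p) :
    heis p (v, z) ∘ₗ gaussOp p m = ∑ s : ZMod p × ZMod p,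
      psi p ((4 : ZMod p)⁻¹ * omg (matVec m (s - v)) (s - v) + (z + 2⁻¹ * omg v s)) •
        heis p (s, 0) := by
  rw [gaussOp, ← Module.End.mul_eq_comp, Finset.mul_sum]
  refine Fintype.sum_equiv (Equiv.addLeft v) _ _ fun u => ?_
  simp only [Equiv.coe_addLeft, add_sub_cancel_left]
  rw [Module.End.mul_eq_comp, LinearMap.comp_smul, heis_comp hp, hMul, heis_eq_smul, smul_smul,
    ← psi_add]
  congr 3
  simp only [omg, Prod.fst_add, Prod.snd_add]
  ring

theorem four_eq_two_mul_two : (4 : ZMod p) = 2 * 2 := by norm_num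

theorem omg_matVec_sub_one_eq_zero_iff [Fact p.Prime] (m : Matrix (Fin 2) (Fin 2) (ZMod p))
    (hm : (m - 1).det ≠ 0) (s : ZMod p × ZMod p) :
    ((m 0 0 - 1) * s.2 - m 1 0 * s.1 = 0 ∧ m 0 1 * s.2 - (m 1 1 - 1) * s.1 = 0) ↔ s = 0 := by
  constructor
  · rintro ⟨h1, h2⟩
    simp only [Matrix.det_fin_two, Matrix.sub_apply, Matrix.one_apply_eq, ne_eq, zero_ne_one,
      one_ne_zero, not_false_eq_true, Matrix.one_apply_ne, sub_zero] at hm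
    refine Prod.ext (mul_left_cancel₀ hm ?_) (mul_left_cancel₀ hm ?_)
    · simp only [Prod.fst_zero]
      linear_combination m 0 1 * h1 - (m 0 0 - 1) * h2
    · simp only [Prod.snd_zero]
      linear_combination (m 1 1 - 1) * h1 - m 1 0 * h2
  · rintro rfl
    simp

/-- Up to the scalar `p ^ 2`, the adjoint Gauss sum inverts `gaussOp p m`. -/
theorem sum_comp_gaussOp [Fact p.Prime] (hp : p ≠ 2) (m : Matrix (Fin 2) (Fin 2) (ZMod p))
    (htr : m 1 1 = -m 0 0) (hm : (m - 1).det ≠ 0) :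
    (∑ u : ZMod p × ZMod p, psi p (-((4 : ZMod p)⁻¹ * omg (matVec m u) u)) • heis p (-u, 0)) ∘ₗ
      gaussOp p m = ((p : ℂ) ^ 2) • LinearMap.id := by
  have h2 := two_ne_zero_of_prime hp
  have key : ∀ s u : ZMod p × ZMod p,
      -((4 : ZMod p)⁻¹ * omg (matVec m u) u) +
        (4⁻¹ * omg (matVec m (s - -u)) (s - -u) + (0 + 2⁻¹ * omg (-u) s)) =
      4⁻¹ * omg (matVec m s) s + (u.1 * (2⁻¹ * ((m 0 0 - 1) * s.2 - m 1 0 * s.1)) +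
        u.2 * (2⁻¹ * (m 0 1 * s.2 - (m 1 1 - 1) * s.1))) := by
    intro s u
    rw [four_eq_two_mul_two]
    simp only [omg, matVec, Prod.fst_sub, Prod.snd_sub, Prod.fst_neg, Prod.snd_neg, htr]
    field_simp
    ring
  rw [← Module.End.mul_eq_comp, Finset.sum_mul]
  simp only [Module.End.mul_eq_comp, LinearMap.smul_comp, heis_comp_gaussOp hp, Finset.smul_sum,
    smul_smul, ← psi_add, key]
  rw [Finset.sum_comm]
  simp only [psi_add _ (_ + _), ← Finset.sum_smul, ← Finset.mul_sum, sum_psi_linear, mul_eq_zero,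
    inv_eq_zero, h2, false_or, omg_matVec_sub_one_eq_zero_iff m hm]
  rw [Finset.sum_eq_single 0 (fun s _ hs => by simp [hs]) (by simp)]
  simp [omg, matVec, psi_zero, heis_zero]

theorem gaussOp_bijective [Fact p.Prime] (hp : p ≠ 2) (m : Matrix (Fin 2) (Fin 2) (ZMod p))
    (htr : m 1 1 = -m 0 0) (hm : (m - 1).det ≠ 0) : Function.Bijective (gaussOp p m) := by
  have hp0 : (p : ℂ) ^ 2 ≠ 0 := pow_ne_zero _ (Nat.cast_ne_zero.2 (NeZero.ne p))
  have hinj : Function.Injective (gaussOp p m) := by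
    intro f f' hff
    have hc := sum_comp_gaussOp hp m htr hm
    have h1 := LinearMap.congr_fun hc f
    have h2 := LinearMap.congr_fun hc f'
    rw [LinearMap.comp_apply, hff, ← LinearMap.comp_apply, h2] at h1
    exact (smul_right_injective _ hp0 h1).symm
  exact ⟨hinj, LinearMap.injective_iff_surjective.1 hinj⟩

section Cayley

variable [Fact p.Prime] {g : Matrix (Fin 2) (Fin 2) (ZMod p)}

theorem cayley_sub_one_mul (hgI : (g - 1).det ≠ 0) : (cayley g - 1) * (g - 1) = 2 := by
  rw [cayley, sub_mul, Matrix.mul_assoc, Matrix.nonsing_inv_mul _ (isUnit_iff_ne_zero.2 hgI)]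
  rw [one_mul, mul_one, add_sub_sub_cancel, one_add_one_eq_two]

theorem cayley_add_one_mul (hgI : (g - 1).det ≠ 0) : (cayley g + 1) * (g - 1) = 2 * g := by
  rw [cayley, add_mul, Matrix.mul_assoc, Matrix.nonsing_inv_mul _ (isUnit_iff_ne_zero.2 hgI)]
  noncomm_ring

theorem det_two_ne_zero (hp : p ≠ 2) : (2 : Matrix (Fin 2) (Fin 2) (ZMod p)).det ≠ 0 := by
  have h2 := two_ne_zero_of_prime hp
  rw [Matrix.det_fin_two]
  simp [Matrix.ofNat_apply, h2]

theorem det_cayley_sub_one_ne_zero (hp : p ≠ 2) (hgI : (g - 1).det ≠ 0) :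
    (cayley g - 1).det ≠ 0 := by
  have h := congrArg Matrix.det (cayley_sub_one_mul hgI)
  rw [Matrix.det_mul] at h
  exact left_ne_zero_of_mul (h ▸ det_two_ne_zero hp)

theorem det_cayley_add_one_ne_zero (hp : p ≠ 2) (hg : g.det = 1) (hgI : (g - 1).det ≠ 0) :
    (cayley g + 1).det ≠ 0 := by
  have h := congrArg Matrix.det (cayley_add_one_mul hgI)
  rw [Matrix.det_mul, Matrix.det_mul, hg, mul_one] at h
  exact left_ne_zero_of_mul (h ▸ det_two_ne_zero hp)

theorem cayley_eq (hg : g.det = 1) : cayley g = (2 - g 0 0 - g 1 1)⁻¹ •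
    !![g 1 1 - g 0 0, -2 * g 0 1; -2 * g 1 0, g 0 0 - g 1 1] := by
  have hd : (g - 1).det = 2 - g 0 0 - g 1 1 := by
    rw [Matrix.det_fin_two] at hg ⊢
    simp
    linear_combination hg
  rw [cayley, Matrix.inv_def, hd, Ring.inverse_eq_inv', Matrix.mul_smul, Matrix.adjugate_fin_two]
  rw [Matrix.det_fin_two] at hg
  congr 1
  ext i j
  fin_cases i <;> fin_cases j <;> simp [Matrix.mul_apply, Fin.sum_univ_two]
  · linear_combination hg
  · ring
  · ring
  · linear_combination hg

theorem gaussOp_cayley_comp_heis (hp : p ≠ 2) (hg : g.det = 1) (hgI : (g - 1).det ≠ 0)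
    (v : ZMod p × ZMod p) (z : ZMod p) :
    gaussOp p (cayley g) ∘ₗ heis p (v, z) = heis p (matVec g v, z) ∘ₗ gaussOp p (cayley g) := by
  have h2 := two_ne_zero_of_prime hp
  rw [gaussOp_comp_heis hp, heis_comp_gaussOp hp]
  refine Finset.sum_congr rfl fun s _ => ?_
  congr 2
  have hd : 2 - g 0 0 - g 1 1 ≠ 0 := by
    convert hgI using 1
    rw [Matrix.det_fin_two] at hg ⊢
    simp
    linear_combination -hg
  rw [cayley_eq hg, four_eq_two_mul_two]
  rw [Matrix.det_fin_two] at hg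
  simp only [omg, matVec, Prod.fst_sub, Prod.snd_sub, Matrix.smul_apply, Matrix.of_apply,
    Matrix.cons_val', Matrix.cons_val_zero, Matrix.cons_val_one, Matrix.cons_val_fin_one,
    smul_eq_mul]
  generalize g 0 0 = a, g 0 1 = b, g 1 0 = c, g 1 1 = d at *
  obtain ⟨x, y⟩ := s
  obtain ⟨t, w⟩ := v
  field_simp
  linear_combination (4 * (t * y - w * x) - (2 * (d - a) * t * w -
    2 * b * w ^ 2 + 2 * c * t ^ 2)) * hg

end Cayley

theorem sgm_ne_zero {a : ZMod p} (ha : a ≠ 0) : sgm p a ≠ 0 := by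
  rw [sgm, if_neg ha]
  split_ifs <;> norm_num

theorem weilOp_eq_smul [Fact p.Prime] (g : Matrix (Fin 2) (Fin 2) (ZMod p)) :
    weilOp p g = ((p : ℂ)⁻¹ * sgm p (-((cayley g + 1).det))) • gaussOp p (cayley g) := by
  rw [weilOp, gaussOp, smul_smul]

/-- Egorov property of the kernel-formula Weil operators. -/
theorem stmt6 (p : ℕ) [Fact p.Prime] (hp : p ≠ 2)
    (g : Matrix (Fin 2) (Fin 2) (ZMod p)) (hg : g.det = 1) (hgI : (g - 1).det ≠ 0) :
    Function.Bijective (weilOp p g) ∧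
    ∀ (v : ZMod p × ZMod p) (z : ZMod p),
      weilOp p g ∘ₗ heis p (v, z) = heis p (matVec g v, z) ∘ₗ weilOp p g := by
  have hc : (p : ℂ)⁻¹ * sgm p (-((cayley g + 1).det)) ≠ 0 :=
    mul_ne_zero (inv_ne_zero (Nat.cast_ne_zero.2 (NeZero.ne p)))
      (sgm_ne_zero (neg_ne_zero.2 (det_cayley_add_one_ne_zero hp hg hgI)))
  have htr : cayley g 1 1 = -cayley g 0 0 := by
    rw [cayley_eq hg]
    simp
    ring
  rw [weilOp_eq_smul]
  constructor
  · have hb := gaussOp_bijective hp (cayley g) htr (det_cayley_sub_one_ne_zero hp hgI)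
    exact (MulAction.bijective (Units.mk0 _ hc)).comp hb
  · intro v z
    rw [LinearMap.smul_comp, LinearMap.comp_smul, gaussOp_cayley_comp_heis hp hg hgI]

end DFTWeil
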